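/- Let k ≥ 4 and let δ be a set partition of [k] having exactly one block of size 2 and all other blocks singletons. Then for every n > k, |Π_n(δ)| < |Π_n(σ_k)|, where σ_k is the set partition of [k] all of whose blocks are singletons. -/

import Mathlib

open Finset

/-- The ground set `[n] = {1, …, n}`. -/
def Idx (n : ℕ) : Finset ℕ := Finset.Icc 1 n

/-- `i` and `j` lie in the same block of the set partition `π`. -/
def SameBlock {n : ℕ} (π : Finpartition (Idx n)) (i j : ℕ) : Prop :=
  ∃ B ∈ π.parts, i ∈ B ∧ j ∈ B

/-- Klazar containment: `σ ⊢ [n]` contains `τ ⊢ [k]` if there is a strictly increasing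
map `f : [k] → [n]` such that `i, j` are in the same block of `τ` iff `f i, f j` are in
the same block of `σ`. -/
def Contains {k n : ℕ} (τ : Finpartition (Idx k)) (σ : Finpartition (Idx n)) : Prop :=
  ∃ f : ℕ → ℕ, StrictMonoOn f (Idx k) ∧ (∀ i ∈ Idx k, f i ∈ Idx n) ∧
    ∀ i ∈ Idx k, ∀ j ∈ Idx k, (SameBlock τ i j ↔ SameBlock σ (f i) (f j))

/-- `σ` avoids the pattern `τ`. -/
def Avoids {k n : ℕ} (σ : Finpartition (Idx n)) (τ : Finpartition (Idx k)) : Prop :=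
  ¬ Contains τ σ

/-- `|Π_n(τ)|`, the number of set partitions of `[n]` avoiding `τ`. -/
noncomputable def avoidCount (n : ℕ) {k : ℕ} (τ : Finpartition (Idx k)) : ℕ :=
  Nat.card {σ : Finpartition (Idx n) // Avoids σ τ}

/-- The family `P` consists of the blocks of a set partition of `S`. -/
def IsPartitionOf (S : Finset ℕ) (P : Finset (Finset ℕ)) : Prop :=
  (∀ B ∈ P, B ⊆ S) ∧ (∀ a ∈ S, ∃! B ∈ P, a ∈ B) ∧ ∅ ∉ P

/-- `x` and `y` lie in a common member of the family `P`. -/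
def Related (P : Finset (Finset ℕ)) (x y : ℕ) : Prop :=
  ∃ B ∈ P, x ∈ B ∧ y ∈ B

/-- The family `P` contains the pattern with `p + q + r + 2` points whose only doubleton has
`p` points before it, `q` points between its elements, and `r` points after it. -/
def HasDoubletonPattern (p q r : ℕ) (P : Finset (Finset ℕ)) : Prop :=
  ∃ f : ℕ → ℕ, (∀ i j, i < j → j < p + q + r + 2 → f i < f j) ∧
    (∀ i < p + q + r + 2, Related P (f i) (f i)) ∧
    ∀ i j, i < j → j < p + q + r + 2 →
      (Related P (f i) (f j) ↔ i = p ∧ j = p + q + 1)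

/-- Set partitions of `S` without the doubleton pattern. -/
def doubletonAvoiders (p q r : ℕ) (S : Finset ℕ) : Set (Finset (Finset ℕ)) :=
  {P | IsPartitionOf S P ∧ ¬ HasDoubletonPattern p q r P}

/-- Set partitions of `S` with at most `m` blocks. -/
def fewBlocks (m : ℕ) (S : Finset ℕ) : Set (Finset (Finset ℕ)) :=
  {P | IsPartitionOf S P ∧ P.card ≤ m}

/-- There is an injection of `X` into `Y`. -/
def Embeds (X Y : Set (Finset (Finset ℕ))) : Prop :=
  ∃ Φ : Finset (Finset ℕ) → Finset (Finset ℕ), Set.MapsTo Φ X Y ∧ Set.InjOn Φ X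

/-- Set partitions of `S` that fall into the class `X` once the block of `v` is removed. -/
def peel (v : ℕ) (X : Finset ℕ → Set (Finset (Finset ℕ))) (S : Finset ℕ) :
    Set (Finset (Finset ℕ)) :=
  {P | IsPartitionOf S P ∧ ∃ B, B ∈ P ∧ v ∈ B ∧ P.erase B ∈ X (S \ B)}

/-- The partition of `S` into the fibres of `g`. -/
def fibrePartition (S : Finset ℕ) (g : ℕ → ℕ) : Finset (Finset ℕ) :=
  (S.image g).image fun v => S.filter (g · = v)

/-- Set partitions whose restricted growth function `w` satisfies `w y < w x + q`
whenever `y < x`. -/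
def narrowPartitions (q : ℕ) (S : Finset ℕ) : Set (Finset (Finset ℕ)) :=
  {P | IsPartitionOf S P ∧ ∃ w : ℕ → ℕ,
    (∀ x ∈ S, ∀ y ∈ S, (Related P x y ↔ w x = w y)) ∧
    (∀ x ∈ S, ∀ v < w x, ∃ y ∈ S, y < x ∧ w y = v) ∧
    ∀ x ∈ S, ∀ y ∈ S, y < x → w y < w x + q}

theorem related_erase_iff {P : Finset (Finset ℕ)} {B : Finset ℕ} {x y : ℕ} (hx : x ∉ B) :
    Related (P.erase B) x y ↔ Related P x y := by
  constructor
  · rintro ⟨C, hC, hxC, hyC⟩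
    exact ⟨C, mem_of_mem_erase hC, hxC, hyC⟩
  · rintro ⟨C, hC, hxC, hyC⟩
    refine ⟨C, mem_erase.2 ⟨?_, hC⟩, hxC, hyC⟩
    rintro rfl
    exact hx hxC

namespace IsPartitionOf

variable {S : Finset ℕ} {P Q : Finset (Finset ℕ)} {B C : Finset ℕ} {x y z : ℕ}

theorem block_unique (h : IsPartitionOf S P) (hB : B ∈ P) (hC : C ∈ P) (hxB : x ∈ B)
    (hxC : x ∈ C) : B = C :=
  (h.2.1 x (h.1 B hB hxB)).unique ⟨hB, hxB⟩ ⟨hC, hxC⟩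

theorem nonempty (h : IsPartitionOf S P) (hB : B ∈ P) : B.Nonempty := by
  rw [Finset.nonempty_iff_ne_empty]
  rintro rfl
  exact h.2.2 hB

theorem related_refl (h : IsPartitionOf S P) (hx : x ∈ S) : Related P x x := by
  obtain ⟨B, ⟨hB, hxB⟩, -⟩ := h.2.1 x hx
  exact ⟨B, hB, hxB, hxB⟩

theorem related_trans (h : IsPartitionOf S P) (hxy : Related P x y) (hyz : Related P y z) :
    Related P x z := by
  obtain ⟨B, hB, hx, hy⟩ := hxy
  obtain ⟨C, hC, hy', hz⟩ := hyz
  obtain rfl := h.block_unique hB hC hy hy'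
  exact ⟨B, hB, hx, hz⟩

theorem subset_of_related (hP : IsPartitionOf S P) (hQ : IsPartitionOf S Q)
    (h : ∀ x ∈ S, ∀ y ∈ S, (Related P x y ↔ Related Q x y)) : P ⊆ Q := by
  intro B hB
  obtain ⟨x, hx⟩ := hP.nonempty hB
  have hxS := hP.1 B hB hx
  obtain ⟨C, ⟨hC, hxC⟩, -⟩ := hQ.2.1 x hxS
  have hBC : B = C := by
    ext y
    constructor
    · intro hy
      obtain ⟨D, hD, hxD, hyD⟩ := (h x hxS y (hP.1 B hB hy)).1 ⟨B, hB, hx, hy⟩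
      rwa [hQ.block_unique hC hD hxC hxD]
    · intro hy
      obtain ⟨D, hD, hxD, hyD⟩ := (h x hxS y (hQ.1 C hC hy)).2 ⟨C, hC, hxC, hy⟩
      rwa [hP.block_unique hB hD hx hxD]
  rwa [hBC]

theorem eq_of_related (hP : IsPartitionOf S P) (hQ : IsPartitionOf S Q)
    (h : ∀ x ∈ S, ∀ y ∈ S, (Related P x y ↔ Related Q x y)) : P = Q :=
  (hP.subset_of_related hQ h).antisymm
    (hQ.subset_of_related hP fun x hx y hy => (h x hx y hy).symm)

theorem erase (h : IsPartitionOf S P) (hB : B ∈ P) : IsPartitionOf (S \ B) (P.erase B) := by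
  refine ⟨fun C hC => ?_, fun a ha => ?_, fun hempty => h.2.2 (mem_of_mem_erase hempty)⟩
  · intro x hx
    rw [mem_erase] at hC
    rw [mem_sdiff]
    exact ⟨h.1 C hC.2 hx, fun hxB => hC.1 (h.block_unique hC.2 hB hx hxB)⟩
  · rw [mem_sdiff] at ha
    obtain ⟨C, ⟨hC, haC⟩, huniq⟩ := h.2.1 a ha.1
    refine ⟨C, ⟨mem_erase.2 ⟨?_, hC⟩, haC⟩, fun D hD => huniq D ⟨mem_of_mem_erase hD.1, hD.2⟩⟩
    rintro rfl
    exact ha.2 haC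

theorem notMem_of_sdiff (h : IsPartitionOf (S \ B) Q) (hB : B.Nonempty) : B ∉ Q := by
  intro hBQ
  obtain ⟨x, hx⟩ := hB
  exact (mem_sdiff.1 (h.1 B hBQ hx)).2 hx

theorem insert (h : IsPartitionOf (S \ B) Q) (hBS : B ⊆ S) (hB : B.Nonempty) :
    IsPartitionOf S (insert B Q) := by
  refine ⟨fun C hC => ?_, fun a ha => ?_, fun hempty => ?_⟩
  · rcases mem_insert.1 hC with rfl | hC
    · exact hBS
    · exact (h.1 C hC).trans sdiff_subset
  · by_cases haB : a ∈ B
    · refine ⟨B, ⟨mem_insert_self _ _, haB⟩, fun D hD => ?_⟩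
      rcases mem_insert.1 hD.1 with rfl | hDQ
      · rfl
      · exact absurd haB (mem_sdiff.1 (h.1 D hDQ hD.2)).2
    · obtain ⟨C, ⟨hC, haC⟩, huniq⟩ := h.2.1 a (mem_sdiff.2 ⟨ha, haB⟩)
      refine ⟨C, ⟨mem_insert_of_mem hC, haC⟩, fun D hD => ?_⟩
      rcases mem_insert.1 hD.1 with rfl | hDQ
      · exact absurd hD.2 haB
      · exact huniq D ⟨hDQ, hD.2⟩
  · rcases mem_insert.1 hempty with h0 | h0
    · exact hB.ne_empty h0.symm
    · exact h.2.2 h0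

theorem mem_sdiff_of_related_erase (h : IsPartitionOf S P) (hB : B ∈ P)
    (hx : Related (P.erase B) x y) : x ∈ S \ B := by
  obtain ⟨C, hC, hxC, -⟩ := hx
  exact (h.erase hB).1 C hC hxC

theorem not_related_of_mem_of_notMem (h : IsPartitionOf S P) (hB : B ∈ P) (hx : x ∈ B)
    (hy : y ∉ B) : ¬ Related P x y ∧ ¬ Related P y x := by
  constructor <;> rintro ⟨C, hC, h1, h2⟩
  · obtain rfl := h.block_unique hB hC hx h1
    exact hy h2
  · obtain rfl := h.block_unique hB hC hx h2
    exact hy h1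

end IsPartitionOf

theorem isPartitionOf_parts {S : Finset ℕ} (π : Finpartition S) : IsPartitionOf S π.parts :=
  ⟨fun _ hB => π.le hB, fun _ ha => π.existsUnique_mem ha, π.bot_notMem⟩

theorem Embeds.mono {X X' Y : Set (Finset (Finset ℕ))} (h : Embeds X' Y) (hX : X ⊆ X') :
    Embeds X Y := by
  obtain ⟨Φ, hmaps, hinj⟩ := h
  exact ⟨Φ, hmaps.mono_left hX, hinj.mono hX⟩

theorem embeds_peel {v m : ℕ} {X : Finset ℕ → Set (Finset (Finset ℕ))}
    (hX : ∀ S, Embeds (X S) (fewBlocks m S)) (S : Finset ℕ) :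
    Embeds (peel v X S) (fewBlocks (m + 1) S) := by
  classical
  choose Φ hmaps hinj using hX
  have hchoice : ∀ P, ∃ B, P ∈ peel v X S → B ∈ P ∧ v ∈ B ∧ P.erase B ∈ X (S \ B) := by
    intro P
    by_cases hP : P ∈ peel v X S
    · obtain ⟨B, hB⟩ := hP.2
      exact ⟨B, fun _ => hB⟩
    · exact ⟨∅, fun h => absurd h hP⟩
  choose β hβ using hchoice
  have hpart : ∀ P ∈ peel v X S,
      IsPartitionOf S (insert (β P) (Φ (S \ β P) (P.erase (β P)))) := by
    intro P hP
    obtain ⟨hB, hv, hE⟩ := hβ P hP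
    exact (hmaps _ hE).1.insert (hP.1.1 _ hB) ⟨v, hv⟩
  refine ⟨fun P => insert (β P) (Φ (S \ β P) (P.erase (β P))), fun P hP => ?_,
    fun P hP P' hP' heq => ?_⟩
  · refine ⟨hpart P hP, (card_insert_le _ _).trans ?_⟩
    exact Nat.add_le_add_right (hmaps _ (hβ P hP).2.2).2 1
  · obtain ⟨hB, hv, hE⟩ := hβ P hP
    obtain ⟨hB', hv', hE'⟩ := hβ P' hP'
    dsimp only at heq
    have hββ : β P = β P' := by
      refine (hpart P hP).block_unique (mem_insert_self _ _) ?_ hv hv'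
      rw [heq]
      exact mem_insert_self _ _
    have h1 := (hmaps _ hE).1.notMem_of_sdiff ⟨v, hv⟩
    have h2 := (hmaps _ hE').1.notMem_of_sdiff ⟨v, hv'⟩
    rw [← hββ] at heq h2 hE' hB'
    have h3 : Φ (S \ β P) (P.erase (β P)) = Φ (S \ β P) (P'.erase (β P)) := by
      rw [← erase_insert h1, heq, erase_insert h2]
    have h4 := hinj _ hE hE' h3
    rw [← insert_erase hB, h4, insert_erase hB']

theorem HasDoubletonPattern.of_erase_max {p q r v : ℕ} {S B : Finset ℕ}
    {P : Finset (Finset ℕ)} (hP : IsPartitionOf S P) (hB : B ∈ P) (hv : v ∈ B)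
    (hmax : ∀ x ∈ S, x ≤ v) (h : HasDoubletonPattern p q r (P.erase B)) :
    HasDoubletonPattern p q (r + 1) P := by
  obtain ⟨f, hmono, hcov, hrel⟩ := h
  have hmem : ∀ i < p + q + r + 2, f i ∈ S ∧ f i ∉ B := fun i hi =>
    mem_sdiff.1 (hP.mem_sdiff_of_related_erase hB (hcov i hi))
  have hlt : ∀ i < p + q + r + 2, f i < v := fun i hi =>
    lt_of_le_of_ne (hmax _ (hmem i hi).1) fun h => (hmem i hi).2 (h ▸ hv)
  refine ⟨fun i => if i < p + q + r + 2 then f i else v, fun i j hij hj => ?_,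
    fun i hi => ?_, fun i j hij hj => ?_⟩
  · have hi : i < p + q + r + 2 := by omega
    by_cases hj' : j < p + q + r + 2
    · simpa [hi, hj'] using hmono i j hij hj'
    · simpa [hi, hj'] using hlt i hi
  · by_cases hi' : i < p + q + r + 2
    · simpa [hi'] using (related_erase_iff (hmem i hi').2).1 (hcov i hi')
    · simp only [hi', if_false]
      exact ⟨B, hB, hv, hv⟩
  · have hi : i < p + q + r + 2 := by omega
    by_cases hj' : j < p + q + r + 2
    · simpa [hi, hj', related_erase_iff (hmem i hi).2] using hrel i j hij hj'
    · have := (hP.not_related_of_mem_of_notMem hB hv (hmem i hi).2).2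
      simp only [hi, hj', if_true, if_false, this, false_iff]
      omega

theorem HasDoubletonPattern.of_erase_min {p q r v : ℕ} {S B : Finset ℕ}
    {P : Finset (Finset ℕ)} (hP : IsPartitionOf S P) (hB : B ∈ P) (hv : v ∈ B)
    (hmin : ∀ x ∈ S, v ≤ x) (h : HasDoubletonPattern p q r (P.erase B)) :
    HasDoubletonPattern (p + 1) q r P := by
  obtain ⟨f, hmono, hcov, hrel⟩ := h
  have hmem : ∀ i < p + q + r + 2, f i ∈ S ∧ f i ∉ B := fun i hi =>
    mem_sdiff.1 (hP.mem_sdiff_of_related_erase hB (hcov i hi))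
  have hlt : ∀ i < p + q + r + 2, v < f i := fun i hi =>
    lt_of_le_of_ne (hmin _ (hmem i hi).1) fun h => (hmem i hi).2 (h ▸ hv)
  refine ⟨fun i => Nat.casesOn i v f, fun i j hij hj => ?_, fun i hi => ?_,
    fun i j hij hj => ?_⟩
  · obtain ⟨j, rfl⟩ : ∃ j', j = j' + 1 := ⟨j - 1, by omega⟩
    cases i with
    | zero => exact hlt j (by omega)
    | succ i => exact hmono i j (by omega) (by omega)
  · cases i with
    | zero => exact ⟨B, hB, hv, hv⟩
    | succ i =>
      exact (related_erase_iff (hmem i (by omega)).2).1 (hcov i (by omega))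
  · obtain ⟨j, rfl⟩ : ∃ j', j = j' + 1 := ⟨j - 1, by omega⟩
    cases i with
    | zero =>
      have := (hP.not_related_of_mem_of_notMem hB hv (hmem j (by omega)).2).1
      exact iff_of_false this (by omega)
    | succ i =>
      have := hrel i j (by omega) (by omega)
      rw [related_erase_iff (hmem i (by omega)).2] at this
      refine this.trans ?_
      omega

theorem doubletonAvoiders_subset_peel_max {p q r v : ℕ} {S : Finset ℕ} (hv : v ∈ S)
    (hmax : ∀ x ∈ S, x ≤ v) :
    doubletonAvoiders p q (r + 1) S ⊆ peel v (doubletonAvoiders p q r) S := by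
  rintro P ⟨hP, hav⟩
  obtain ⟨B, ⟨hB, hvB⟩, -⟩ := hP.2.1 v hv
  exact ⟨hP, B, hB, hvB, hP.erase hB, fun h => hav (h.of_erase_max hP hB hvB hmax)⟩

theorem doubletonAvoiders_subset_peel_min {p q r v : ℕ} {S : Finset ℕ} (hv : v ∈ S)
    (hmin : ∀ x ∈ S, v ≤ x) :
    doubletonAvoiders (p + 1) q r S ⊆ peel v (doubletonAvoiders p q r) S := by
  rintro P ⟨hP, hav⟩
  obtain ⟨B, ⟨hB, hvB⟩, -⟩ := hP.2.1 v hv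
  exact ⟨hP, B, hB, hvB, hP.erase hB, fun h => hav (h.of_erase_min hP hB hvB hmin)⟩

theorem doubletonAvoiders_empty_embeds (p q r m : ℕ) :
    Embeds (doubletonAvoiders p q r ∅) (fewBlocks m ∅) := by
  refine ⟨id, fun P hP => ⟨hP.1, ?_⟩, Set.injOn_id _⟩
  have : P = ∅ := by
    refine eq_empty_of_forall_notMem fun B hB => ?_
    obtain ⟨x, hx⟩ := hP.1.nonempty hB
    exact absurd (hP.1.1 B hB hx) (notMem_empty x)
  simp [this]

theorem isPartitionOf_fibrePartition (S : Finset ℕ) (g : ℕ → ℕ) :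
    IsPartitionOf S (fibrePartition S g) := by
  refine ⟨fun B hB => ?_, fun a ha => ?_, fun h => ?_⟩
  · obtain ⟨v, -, rfl⟩ := mem_image.1 hB
    exact filter_subset _ _
  · refine ⟨S.filter (g · = g a), ⟨mem_image_of_mem _ (mem_image_of_mem _ ha), by simp [ha]⟩, ?_⟩
    rintro B ⟨hB, haB⟩
    obtain ⟨v, -, rfl⟩ := mem_image.1 hB
    rw [(mem_filter.1 haB).2]
  · obtain ⟨v, hv, hempty⟩ := mem_image.1 h
    obtain ⟨x, hx, rfl⟩ := mem_image.1 hv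
    exact notMem_empty x (hempty ▸ mem_filter.2 ⟨hx, rfl⟩)

theorem related_fibrePartition_iff {S : Finset ℕ} {g : ℕ → ℕ} {x y : ℕ} (hx : x ∈ S)
    (hy : y ∈ S) : Related (fibrePartition S g) x y ↔ g x = g y := by
  constructor
  · rintro ⟨B, hB, hxB, hyB⟩
    obtain ⟨v, -, rfl⟩ := mem_image.1 hB
    rw [(mem_filter.1 hxB).2, (mem_filter.1 hyB).2]
  · intro h
    exact ⟨S.filter (g · = g x), mem_image_of_mem _ (mem_image_of_mem _ hx), by simp [hx],
      by simp [hy, h]⟩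

theorem card_fibrePartition_le {S : Finset ℕ} {g : ℕ → ℕ} {m : ℕ} (hg : ∀ x ∈ S, g x < m) :
    (fibrePartition S g).card ≤ m := by
  refine card_image_le.trans ?_
  have : S.image g ⊆ range m := fun v hv => by
    obtain ⟨x, hx, rfl⟩ := mem_image.1 hv
    exact mem_range.2 (hg x hx)
  simpa using card_le_card this

theorem not_lt_of_growth_of_mod {q x : ℕ} {S : Finset ℕ} {w w' : ℕ → ℕ}
    (hwin : ∀ y ∈ S, y < x → w y < w x + q)
    (hgrow' : ∀ v < w' x, ∃ y ∈ S, y < x ∧ w' y = v)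
    (hmod : ∀ y ∈ S, w x % (q + 1) = w y % (q + 1) → w' x % (q + 1) = w' y % (q + 1))
    (ih : ∀ y ∈ S, y < x → w y = w' y) : ¬ w x < w' x := by
  intro hlt
  obtain ⟨y, hy, hyx, hwy⟩ := hgrow' _ hlt
  have h1 : w' x % (q + 1) = w x % (q + 1) := by
    rw [← hwy]
    exact hmod y hy (by rw [ih y hy hyx, hwy])
  obtain ⟨z, hz, hzx, hwz⟩ := hgrow' (w' x - 1) (by omega)
  have h2 := hwin z hz hzx
  rw [ih z hz hzx, hwz] at h2
  have h3 : q + 1 ∣ w' x - w x := (Nat.modEq_iff_dvd' hlt.le).1 h1.symm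
  have h4 := Nat.le_of_dvd (by omega) h3
  omega

theorem eqOn_of_growth_of_mod {q : ℕ} {S : Finset ℕ} {w w' : ℕ → ℕ}
    (hgrow : ∀ x ∈ S, ∀ v < w x, ∃ y ∈ S, y < x ∧ w y = v)
    (hgrow' : ∀ x ∈ S, ∀ v < w' x, ∃ y ∈ S, y < x ∧ w' y = v)
    (hwin : ∀ x ∈ S, ∀ y ∈ S, y < x → w y < w x + q)
    (hwin' : ∀ x ∈ S, ∀ y ∈ S, y < x → w' y < w' x + q)
    (hmod : ∀ x ∈ S, ∀ y ∈ S,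
      (w x % (q + 1) = w y % (q + 1) ↔ w' x % (q + 1) = w' y % (q + 1))) :
    ∀ x ∈ S, w x = w' x := by
  intro x
  induction x using Nat.strong_induction_on with
  | _ x ih =>
    intro hx
    refine le_antisymm ?_ ?_
    · exact not_lt.1 (not_lt_of_growth_of_mod (hwin' x hx) (hgrow x hx)
        (fun y hy => (hmod x hx y hy).2) fun y hy hyx => (ih y hyx hy).symm)
    · exact not_lt.1 (not_lt_of_growth_of_mod (hwin x hx) (hgrow' x hx)
        (fun y hy => (hmod x hx y hy).1) fun y hy hyx => ih y hyx hy)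

theorem narrowPartitions_embeds (q : ℕ) (S : Finset ℕ) :
    Embeds (narrowPartitions q S) (fewBlocks (q + 1) S) := by
  have hchoice : ∀ P, ∃ w : ℕ → ℕ, P ∈ narrowPartitions q S →
      (∀ x ∈ S, ∀ y ∈ S, (Related P x y ↔ w x = w y)) ∧
      (∀ x ∈ S, ∀ v < w x, ∃ y ∈ S, y < x ∧ w y = v) ∧
      ∀ x ∈ S, ∀ y ∈ S, y < x → w y < w x + q := by
    intro P
    by_cases hP : P ∈ narrowPartitions q S
    · obtain ⟨w, hw⟩ := hP.2
      exact ⟨w, fun _ => hw⟩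
    · exact ⟨id, fun h => absurd h hP⟩
  choose w hw using hchoice
  refine ⟨fun P => fibrePartition S fun x => w P x % (q + 1), fun P _ =>
    ⟨isPartitionOf_fibrePartition _ _, card_fibrePartition_le fun x _ =>
      Nat.mod_lt _ q.succ_pos⟩, fun P hP P' hP' heq => ?_⟩
  obtain ⟨hrel, hgrow, hwin⟩ := hw P hP
  obtain ⟨hrel', hgrow', hwin'⟩ := hw P' hP'
  dsimp only at heq
  have hww := eqOn_of_growth_of_mod hgrow hgrow' hwin hwin' fun x hx y hy => by
    rw [← related_fibrePartition_iff (g := fun x => w P x % (q + 1)) hx hy, heq,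
      related_fibrePartition_iff hx hy]
  refine hP.1.eq_of_related hP'.1 fun x hx y hy => ?_
  rw [hrel x hx y hy, hrel' x hx y hy, hww x hx, hww y hy]

theorem Related.symm {P : Finset (Finset ℕ)} {x y : ℕ} (h : Related P x y) : Related P y x := by
  obtain ⟨B, hB, hx, hy⟩ := h
  exact ⟨B, hB, hy, hx⟩

/-- The least element of the block of `x`. -/
noncomputable def blockMin (P : Finset (Finset ℕ)) (x : ℕ) : ℕ :=
  sInf {z | Related P x z}

namespace IsPartitionOf

variable {S : Finset ℕ} {P : Finset (Finset ℕ)} {x y : ℕ}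

theorem related_blockMin (h : IsPartitionOf S P) (hx : x ∈ S) : Related P x (blockMin P x) :=
  Nat.sInf_mem (s := {z | Related P x z}) ⟨x, h.related_refl hx⟩

theorem blockMin_le (h : IsPartitionOf S P) (hx : x ∈ S) : blockMin P x ≤ x :=
  Nat.sInf_le (h.related_refl hx)

theorem blockMin_mem (h : IsPartitionOf S P) (hx : x ∈ S) : blockMin P x ∈ S := by
  obtain ⟨B, hB, -, hm⟩ := h.related_blockMin hx
  exact h.1 B hB hm

theorem blockMin_eq_iff (h : IsPartitionOf S P) (hx : x ∈ S) (hy : y ∈ S) :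
    blockMin P x = blockMin P y ↔ Related P x y := by
  constructor
  · intro heq
    have h1 := h.related_blockMin hx
    rw [heq] at h1
    exact h.related_trans h1 (h.related_blockMin hy).symm
  · intro hxy
    unfold blockMin
    congr 1
    ext z
    exact ⟨h.related_trans hxy.symm, h.related_trans hxy⟩

theorem blockMin_blockMin (h : IsPartitionOf S P) (hx : x ∈ S) :
    blockMin P (blockMin P x) = blockMin P x :=
  (h.blockMin_eq_iff (h.blockMin_mem hx) hx).2 (h.related_blockMin hx).symm

end IsPartitionOf

theorem doubletonAvoiders_subset_narrowPartitions (q : ℕ) (S : Finset ℕ) :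
    doubletonAvoiders 0 q 0 S ⊆ narrowPartitions q S := by
  classical
  rintro P ⟨hP, hav⟩
  let M : ℕ → Prop := fun z => z ∈ S ∧ blockMin P z = z
  have hM : ∀ x ∈ S, M (blockMin P x) := fun x hx =>
    ⟨hP.blockMin_mem hx, hP.blockMin_blockMin hx⟩
  have hcard : ∀ x ∈ S, ∀ v ≤ Nat.count M (blockMin P x),
      ∀ hf : (Set.ofPred M).Finite, v < hf.toFinset.card := fun x hx v hv hf =>
    hv.trans_lt (Nat.count_lt_card hf (hM x hx))
  refine ⟨hP, fun x => Nat.count M (blockMin P x), fun x hx y hy => ?_, fun x hx v hv => ?_,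
    fun x hx y hy hyx => ?_⟩
  · rw [← hP.blockMin_eq_iff hx hy]
    exact ⟨fun h => congrArg (Nat.count M) h, fun h => Nat.count_injective (hM x hx) (hM y hy) h⟩
  · have hmem : M (Nat.nth M v) := Nat.nth_mem v (hcard x hx v hv.le)
    refine ⟨Nat.nth M v, hmem.1, (Nat.nth_lt_of_lt_count hv).trans_le (hP.blockMin_le hx), ?_⟩
    dsimp only
    rw [hmem.2]
    exact Nat.count_nth (hcard x hx v hv.le)
  · by_contra! hge
    apply hav
    set c := Nat.count M (blockMin P x) with hc
    have hbound : ∀ i ≤ q, ∀ hf : (Set.ofPred M).Finite, c + i < hf.toFinset.card := fun i hi =>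
      hcard y hy (c + i) (by omega)
    have hmem : ∀ i ≤ q, M (Nat.nth M (c + i)) := fun i hi => Nat.nth_mem _ (hbound i hi)
    have hzero : Nat.nth M c = blockMin P x := Nat.nth_count (hM x hx)
    have hmono : ∀ i j, i < j → j ≤ q → Nat.nth M (c + i) < Nat.nth M (c + j) :=
      fun i j hij hj => Nat.nth_lt_nth' (by omega) (hbound j hj)
    have hlast : ∀ i ≤ q, Nat.nth M (c + i) < x := by
      intro i hi
      have h1 : Nat.nth M (c + i) ≤ Nat.nth M (Nat.count M (blockMin P y)) := by
        rcases (show c + i ≤ Nat.count M (blockMin P y) by omega).eq_or_lt with h | h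
        · rw [h]
        · exact (Nat.nth_lt_nth' h (hcard y hy _ le_rfl)).le
      rw [Nat.nth_count (hM y hy)] at h1
      exact (h1.trans (hP.blockMin_le hy)).trans_lt hyx
    refine ⟨fun i => if i ≤ q then Nat.nth M (c + i) else x, fun i j hij hj => ?_,
      fun i hi => ?_, fun i j hij hj => ?_⟩
    · have hi : i ≤ q := by omega
      by_cases hj' : j ≤ q
      · simpa [hi, hj'] using hmono i j hij hj'
      · simpa [hi, hj'] using hlast i hi
    · apply hP.related_refl
      by_cases hi' : i ≤ q
      · simpa [hi'] using (hmem i hi').1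
      · simpa [hi'] using hx
    · have hi : i ≤ q := by omega
      by_cases hj' : j ≤ q
      · have hne := (hmono i j hij hj').ne
        simp only [hi, hj', if_true]
        rw [← hP.blockMin_eq_iff (hmem i hi).1 (hmem j hj').1, (hmem i hi).2, (hmem j hj').2]
        exact ⟨fun h => absurd h hne, by omega⟩
      · simp only [hi, hj', if_true, if_false]
        rw [← hP.blockMin_eq_iff (hmem i hi).1 hx, (hmem i hi).2, ← hzero]
        constructor
        · intro h
          refine ⟨?_, by omega⟩
          by_contra hne
          exact (hmono 0 i (by omega) hi).ne' h
        · rintro ⟨rfl, -⟩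
          rfl

theorem doubletonAvoiders_embeds_of_right_zero (p q : ℕ) :
    ∀ S, Embeds (doubletonAvoiders p q 0 S) (fewBlocks (p + q + 1) S) := by
  induction p with
  | zero =>
    intro S
    simpa using (narrowPartitions_embeds q S).mono (doubletonAvoiders_subset_narrowPartitions q S)
  | succ p ih =>
    intro S
    rcases S.eq_empty_or_nonempty with rfl | hS
    · exact doubletonAvoiders_empty_embeds _ _ _ _
    · rw [show p + 1 + q + 1 = p + q + 1 + 1 by omega]
      exact (embeds_peel ih S).mono
        (doubletonAvoiders_subset_peel_min (S.min'_mem hS) fun x hx => S.min'_le x hx)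

theorem doubletonAvoiders_embeds (p q r : ℕ) :
    ∀ S, Embeds (doubletonAvoiders p q r S) (fewBlocks (p + q + r + 1) S) := by
  induction r with
  | zero => exact doubletonAvoiders_embeds_of_right_zero p q
  | succ r ih =>
    intro S
    rcases S.eq_empty_or_nonempty with rfl | hS
    · exact doubletonAvoiders_empty_embeds _ _ _ _
    · exact (embeds_peel ih S).mono
        (doubletonAvoiders_subset_peel_max (S.max'_mem hS) fun x hx => S.le_max' x hx)

theorem isPartitionOf_image_singleton (S : Finset ℕ) :
    IsPartitionOf S (S.image fun x => {x}) := by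
  refine ⟨fun B hB => ?_, fun a ha => ?_, by simp⟩
  · obtain ⟨x, hx, rfl⟩ := mem_image.1 hB
    simpa using hx
  · refine ⟨{a}, ⟨mem_image_of_mem _ ha, mem_singleton_self a⟩, ?_⟩
    rintro B ⟨hB, haB⟩
    obtain ⟨x, -, rfl⟩ := mem_image.1 hB
    rw [mem_singleton.1 haB]

theorem Related.eq_of_image_singleton {S : Finset ℕ} {x y : ℕ}
    (h : Related (S.image fun x => {x}) x y) : x = y := by
  obtain ⟨B, hB, hx, hy⟩ := h
  obtain ⟨z, -, rfl⟩ := mem_image.1 hB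
  rw [mem_singleton.1 hx, mem_singleton.1 hy]

theorem exists_mem_peel_hasDoubletonPattern {p q r p' q' r' v : ℕ} {S B : Finset ℕ}
    (hv : v ∈ B) (hBS : B ⊆ S) {f : ℕ → ℕ} (hmono : StrictMono f)
    (hf : ∀ i < p + q + r + 2, f i ∈ S)
    (hfB : ∀ i < p + q + r + 2, (f i ∈ B ↔ i = p ∨ i = p + q + 1)) :
    ∃ P ∈ peel v (doubletonAvoiders p' q' r') S, HasDoubletonPattern p q r P := by
  have hQ := isPartitionOf_image_singleton (S \ B)
  have hP := hQ.insert hBS ⟨v, hv⟩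
  have hBmem := mem_insert_self B ((S \ B).image fun x => {x})
  have hBerase := erase_insert (hQ.notMem_of_sdiff ⟨v, hv⟩)
  refine ⟨_, ⟨hP, B, hBmem, hv, ?_⟩, f, fun i j hij _ => hmono hij,
    fun i hi => hP.related_refl (hf i hi), fun i j hij hj => ?_⟩
  · rw [hBerase]
    refine ⟨hQ, ?_⟩
    rintro ⟨g, hg, -, hrel⟩
    exact (hg p' (p' + q' + 1) (by omega) (by omega)).ne
      ((hrel _ _ (by omega) (by omega)).2 ⟨rfl, rfl⟩).eq_of_image_singleton
  · have hi : i < p + q + r + 2 := by omega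
    constructor
    · intro h
      by_cases hiB : f i ∈ B
      · by_cases hjB : f j ∈ B
        · have h1 := (hfB i hi).1 hiB
          have h2 := (hfB j hj).1 hjB
          omega
        · exact absurd h (hP.not_related_of_mem_of_notMem hBmem hiB hjB).1
      · rw [← related_erase_iff hiB, hBerase] at h
        exact absurd h.eq_of_image_singleton (hmono hij).ne
    · rintro ⟨rfl, rfl⟩
      exact ⟨B, hBmem, (hfB _ hi).2 (.inl rfl), (hfB _ hj).2 (.inr rfl)⟩

theorem exists_narrowPartition_hasDoubletonPattern {q n : ℕ} (hq : 2 ≤ q) (hn : q + 2 < n) :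
    ∃ P ∈ narrowPartitions q (Icc 1 n), HasDoubletonPattern 0 q 0 P := by
  let w : ℕ → ℕ := fun x => if x ≤ 2 then x - 1 else if x = 3 then 0 else
    if x ≤ q + 2 then x - 2 else if x = q + 3 then 1 else x - 3
  have hP := isPartitionOf_fibrePartition (Icc 1 n) w
  refine ⟨fibrePartition (Icc 1 n) w, ⟨hP, w, fun x hx y hy => related_fibrePartition_iff hx hy,
    fun x hx v hv => ?_, fun x hx y hy hyx => ?_⟩, fun i => i + 2, fun i j hij _ => by dsimp only; omega,
    fun i hi => hP.related_refl (by rw [mem_Icc]; dsimp only; omega), fun i j hij hj => ?_⟩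
  · rw [mem_Icc] at hx
    refine ⟨if v ≤ 1 then v + 1 else if v ≤ q then v + 2 else v + 3, ?_⟩
    rw [mem_Icc]
    simp only [w] at hv ⊢
    split_ifs at hv ⊢ <;> omega
  · rw [mem_Icc] at hx hy
    simp only [w]
    split_ifs <;> omega
  · dsimp only
    rw [related_fibrePartition_iff (by rw [mem_Icc]; omega) (by rw [mem_Icc]; omega)]
    simp only [w]
    split_ifs <;> first | omega | exact iff_of_false id (by omega)

theorem exists_superset_doubletonAvoiders (p q r : ℕ) (hk : 2 ≤ p + q + r) {n : ℕ}
    (hn : p + q + r + 2 < n) :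
    ∃ X, doubletonAvoiders p q r (Icc 1 n) ⊆ X ∧
      Embeds X (fewBlocks (p + q + r + 1) (Icc 1 n)) ∧ ∃ P ∈ X, IsPartitionOf (Icc 1 n) P ∧
        HasDoubletonPattern p q r P := by
  rcases r with _ | r
  · rcases p with _ | p
    · obtain ⟨P, hP, hpat⟩ := exists_narrowPartition_hasDoubletonPattern (q := q) (n := n)
        (by omega) (by omega)
      exact ⟨_, doubletonAvoiders_subset_narrowPartitions q _,
        by simpa using narrowPartitions_embeds q (Icc 1 n), P, hP, hP.1, hpat⟩
    · obtain ⟨P, hP, hpat⟩ := exists_mem_peel_hasDoubletonPattern (p := p + 1) (q := q) (r := 0)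
        (p' := p) (q' := q) (r' := 0) (v := 1) (S := Icc 1 n)
        (B := {1, n - q - 1, n})
        (f := fun i => i + (n - (p + q + 2))) (by simp)
        (by intro x; simp only [mem_insert, mem_singleton, mem_Icc]; omega)
        (fun i j hij => by dsimp only; omega)
        (fun i hi => by rw [mem_Icc]; omega)
        (fun i hi => by simp only [mem_insert, mem_singleton]; omega)
      refine ⟨_, doubletonAvoiders_subset_peel_min (by rw [mem_Icc]; omega)
        (fun x hx => (mem_Icc.1 hx).1), ?_, P, hP, hP.1, hpat⟩
      rw [show p + 1 + q + 0 + 1 = p + q + 0 + 1 + 1 by omega]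
      exact embeds_peel (doubletonAvoiders_embeds p q 0) _
  · obtain ⟨P, hP, hpat⟩ := exists_mem_peel_hasDoubletonPattern (p := p) (q := q) (r := r + 1)
      (p' := p) (q' := q) (r' := r) (v := n) (S := Icc 1 n)
      (B := {p + 1, p + q + 2, n}) (f := fun i => i + 1) (by simp)
      (by intro x; simp only [mem_insert, mem_singleton, mem_Icc]; omega)
      (fun i j hij => by dsimp only; omega)
      (fun i hi => by rw [mem_Icc]; omega)
      (fun i hi => by simp only [mem_insert, mem_singleton]; omega)
    exact ⟨_, doubletonAvoiders_subset_peel_max (by rw [mem_Icc]; omega)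
      (fun x hx => (mem_Icc.1 hx).2), embeds_peel (doubletonAvoiders_embeds p q r) _,
      P, hP, hP.1, hpat⟩

theorem IsPartitionOf.exists_finpartition {S : Finset ℕ} {P : Finset (Finset ℕ)}
    (h : IsPartitionOf S P) : ∃ π : Finpartition S, π.parts = P :=
  ⟨Finpartition.ofExistsUnique P h.1 h.2.1 h.2.2, rfl⟩

theorem SameBlock.symm {n : ℕ} {π : Finpartition (Idx n)} {i j : ℕ} (h : SameBlock π i j) :
    SameBlock π j i :=
  Related.symm h

theorem contains_of_hasDoubletonPattern {p q r k n : ℕ} (hk : k = p + q + r + 2)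
    {δ : Finpartition (Idx k)} {σ : Finpartition (Idx n)}
    (hδ : ∀ i ∈ Idx k, ∀ j ∈ Idx k, i < j →
      (SameBlock δ i j ↔ i = p + 1 ∧ j = p + q + 2))
    (h : HasDoubletonPattern p q r σ.parts) : Contains δ σ := by
  obtain ⟨f, hmono, hcov, hrel⟩ := h
  have hlt : ∀ i ∈ Idx k, ∀ j ∈ Idx k, i < j →
      (SameBlock δ i j ↔ SameBlock σ (f (i - 1)) (f (j - 1))) := by
    intro i hi j hj hij
    rw [hδ i hi j hj hij]
    rw [Idx, mem_Icc] at hi hj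
    refine Iff.trans ?_ (hrel (i - 1) (j - 1) (by omega) (by omega)).symm
    omega
  have hidx : ∀ i ∈ Idx k, i - 1 < p + q + r + 2 := by
    intro i hi
    rw [Idx, mem_Icc] at hi
    omega
  refine ⟨fun i => f (i - 1), fun i hi j hj hij => ?_, fun i hi => ?_, fun i hi j hj => ?_⟩
  · simp only [Idx, coe_Icc, Set.mem_Icc] at hi hj
    exact hmono _ _ (by omega) (by omega)
  · obtain ⟨B, hB, hx, -⟩ := hcov (i - 1) (hidx i hi)
    exact σ.le hB hx
  · rcases lt_trichotomy i j with h | rfl | h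
    · exact hlt i hi j hj h
    · exact ⟨fun _ => hcov (i - 1) (hidx i hi), fun _ => (isPartitionOf_parts δ).related_refl hi⟩
    · have := hlt j hj i hi h
      exact ⟨fun h => (this.1 h.symm).symm, fun h => (this.2 h.symm).symm⟩

theorem avoids_singletons_of_card_parts_lt {k n : ℕ} {σk : Finpartition (Idx k)}
    (hσk : σk.parts = (Idx k).image (fun x => {x})) {σ : Finpartition (Idx n)}
    (h : σ.parts.card < k) : Avoids σ σk := by
  rintro ⟨f, -, hf, hrel⟩
  have hcard : σ.parts.card < (Idx k).card := by simpa [Idx] using h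
  obtain ⟨i, hi, j, hj, hij, hpart⟩ := exists_ne_map_eq_of_card_lt_of_maps_to hcard
    (f := fun i => σ.part (f i)) fun i hi => σ.part_mem.2 (hf i hi)
  refine hij ?_
  have hsame : SameBlock σk i j := by
    rw [hrel i hi j hj]
    refine ⟨σ.part (f i), σ.part_mem.2 (hf i hi), σ.mem_part (hf i hi), ?_⟩
    rw [hpart]
    exact σ.mem_part (hf j hj)
  unfold SameBlock at hsame
  rw [hσk] at hsame
  exact Related.eq_of_image_singleton hsame

theorem exists_doubleton {k : ℕ} (δ : Finpartition (Idx k))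
    (hδ1 : (δ.parts.filter (fun B => B.card = 2)).card = 1)
    (hδ2 : ∀ B ∈ δ.parts, B.card = 1 ∨ B.card = 2) :
    ∃ a b, 1 ≤ a ∧ a < b ∧ b ≤ k ∧ ∀ i j, i < j → (SameBlock δ i j ↔ i = a ∧ j = b) := by
  obtain ⟨B, hB⟩ := card_eq_one.1 hδ1
  have hBmem : B ∈ δ.parts ∧ B.card = 2 := by
    have h := mem_singleton_self B
    rwa [← hB, mem_filter] at h
  obtain ⟨a, b, hab, hBab⟩ : ∃ a b, a < b ∧ B = {a, b} := by
    obtain ⟨x, y, hxy, hBxy⟩ := card_eq_two.1 hBmem.2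
    rcases hxy.lt_or_gt with h | h
    · exact ⟨x, y, h, hBxy⟩
    · exact ⟨y, x, h, by rw [hBxy, pair_comm]⟩
  have ha : a ∈ Idx k := δ.le hBmem.1 (by simp [hBab])
  have hb : b ∈ Idx k := δ.le hBmem.1 (by simp [hBab])
  rw [Idx, mem_Icc] at ha hb
  refine ⟨a, b, ha.1, hab, hb.2, fun i j hij => ⟨?_, ?_⟩⟩
  · rintro ⟨C, hC, hi, hj⟩
    rcases hδ2 C hC with h | h
    · exact absurd (card_le_one.1 h.le i hi j hj) hij.ne
    · have hCB : C = B := by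
        rw [← mem_singleton, ← hB, mem_filter]
        exact ⟨hC, h⟩
      rw [hCB, hBab, mem_insert, mem_singleton] at hi hj
      omega
  · rintro ⟨rfl, rfl⟩
    exact ⟨B, hBmem.1, by simp [hBab], by simp [hBab]⟩

/-- If `δ ⊢ [k]` has exactly one doubleton block and all other blocks singletons, then
`|Π_n(δ)| < |Π_n(σ_k)|` for all `n > k`. -/
theorem avoidCount_oneDoubleton_lt_singletons (k : ℕ) (hk : 4 ≤ k)
    (δ : Finpartition (Idx k))
    (hδ1 : (δ.parts.filter (fun B => B.card = 2)).card = 1)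
    (hδ2 : ∀ B ∈ δ.parts, B.card = 1 ∨ B.card = 2)
    (σk : Finpartition (Idx k)) (hσk : σk.parts = (Idx k).image (fun x => {x})) :
    ∀ n : ℕ, k < n → avoidCount n δ < avoidCount n σk := by
  intro n hn
  obtain ⟨a, b, ha, hab, hbk, hsame⟩ := exists_doubleton δ hδ1 hδ2
  obtain ⟨p, rfl⟩ : ∃ p, a = p + 1 := ⟨a - 1, by omega⟩
  obtain ⟨q, rfl⟩ : ∃ q, b = p + q + 2 := ⟨b - (p + 2), by omega⟩
  obtain ⟨r, hr⟩ : ∃ r, k = p + q + r + 2 := ⟨k - (p + q + 2), by omega⟩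
  have hcontains : ∀ σ : Finpartition (Idx n), HasDoubletonPattern p q r σ.parts →
      Contains δ σ := fun σ =>
    contains_of_hasDoubletonPattern hr fun i _ j _ hij => hsame i j hij
  obtain ⟨X, hsub, ⟨Φ, hmaps, hinj⟩, P, hPX, hP, hpat⟩ :=
    exists_superset_doubletonAvoiders p q r (by omega) (n := n) (by omega)
  obtain ⟨σ, hσ⟩ := IsPartitionOf.exists_finpartition (S := Idx n) hP
  let Y : Set (Finpartition (Idx n)) := {π | π.parts ∈ X}
  have hlt : {π : Finpartition (Idx n) | Avoids π δ}.ncard < Y.ncard := by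
    refine Set.ncard_lt_ncard ⟨fun π hπ => hsub ⟨isPartitionOf_parts π, fun h =>
      hπ (hcontains π h)⟩, fun h => ?_⟩ (Set.toFinite _)
    have hσY : σ ∈ Y := by
      change σ.parts ∈ X
      rwa [hσ]
    exact h hσY (hcontains σ (hσ ▸ hpat))
  have hlift : ∀ π : Finpartition (Idx n), ∃ π' : Finpartition (Idx n),
      π ∈ Y → π'.parts = Φ π.parts := by
    intro π
    by_cases hπ : π ∈ Y
    · obtain ⟨π', hπ'⟩ := IsPartitionOf.exists_finpartition (S := Idx n) (hmaps hπ).1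
      exact ⟨π', fun _ => hπ'⟩
    · exact ⟨π, fun h => absurd h hπ⟩
  choose F hF using hlift
  have hle : Y.ncard ≤ {π : Finpartition (Idx n) | Avoids π σk}.ncard := by
    refine Set.ncard_le_ncard_of_injOn F (fun π hπ => ?_) (fun π hπ π' hπ' heq => ?_)
      (Set.toFinite _)
    · refine avoids_singletons_of_card_parts_lt hσk ?_
      rw [hF π hπ]
      have := (hmaps hπ).2
      omega
    · refine Finpartition.ext (hinj hπ hπ' ?_)
      rw [← hF π hπ, ← hF π' hπ', heq]
  exact hlt.trans_le hle
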